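/- arXiv:2305.02589 — 3 statements merged into one kernel-verified Lean document; each statement's English description precedes it below -/
import Mathlib

section
/- Let 𝒳, 𝒴, 𝒵 be finite sets, p a probability mass function on 𝒳×𝒴×𝒵, and α∈(0,∞) with α≠1. Define p̂ on 𝒳×𝒴×𝒵 by p̂(x,y,z) = p(z) p(x,y|z)^α / ∑_{x',y',z'} p(z') p(x',y'|z')^α. Then H^H_α(XY|Z)_p = H^A_{1/α}(X|YZ)_{p̂} + H^H_α(Y|Z)_p, where in the middle term the conditioning is on the pair (Y,Z). -/
open Finset

/-- `p` is a probability mass function on a finite type. -/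
def IsPMF {Ω : Type*} [Fintype Ω] (p : Ω → ℝ) : Prop :=
  (∀ ω, 0 ≤ p ω) ∧ ∑ ω, p ω = 1

/-- Marginal distribution of the second component. -/
noncomputable def margY {X Y : Type*} [Fintype X] (p : X × Y → ℝ) (y : Y) : ℝ := ∑ x, p (x, y)

/-- Conditional distribution `p(x|y)`. -/
noncomputable def condXY {X Y : Type*} [Fintype X] (p : X × Y → ℝ) (x : X) (y : Y) : ℝ :=
  p (x, y) / margY p y

/-- Hayashi conditional Rényi entropy `H^H_α(X|Y)_p`. -/
noncomputable def HH {X Y : Type*} [Fintype X] [Fintype Y] (α : ℝ) (p : X × Y → ℝ) : ℝ :=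
  (1 / (1 - α)) * Real.log (∑ y, margY p y * ∑ x, condXY p x y ^ α)

/-- Arimoto conditional Rényi entropy `H^A_α(X|Y)_p`. -/
noncomputable def HA {X Y : Type*} [Fintype X] [Fintype Y] (α : ℝ) (p : X × Y → ℝ) : ℝ :=
  (α / (1 - α)) * Real.log (∑ y, margY p y * (∑ x, condXY p x y ^ α) ^ (1 / α))

variable {X Y Z : Type*} [Fintype X] [Fintype Y] [Fintype Z]

/-- Marginal on `Z` of a pmf on `X × Y × Z`. -/
noncomputable def margZ3 (p : X × Y × Z → ℝ) (z : Z) : ℝ := ∑ x, ∑ y, p (x, y, z)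

/-- Conditional distribution `p(x,y|z)`. -/
noncomputable def cond3 (p : X × Y × Z → ℝ) (x : X) (y : Y) (z : Z) : ℝ :=
  p (x, y, z) / margZ3 p z

/-- The tilted pmf `p̂(x,y,z) = p(z) p(x,y|z)^α / ∑ p(z') p(x',y'|z')^α`. -/
noncomputable def tilt3 (α : ℝ) (p : X × Y × Z → ℝ) : X × Y × Z → ℝ := fun (x, y, z) =>
  margZ3 p z * cond3 p x y z ^ α /
    ∑ w : X × Y × Z, margZ3 p w.2.2 * cond3 p w.1 w.2.1 w.2.2 ^ α

/-- View `(X,Y)` as the first variable and `Z` as the conditioning variable. -/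
noncomputable def jointXY_Z (p : X × Y × Z → ℝ) : (X × Y) × Z → ℝ := fun ((x, y), z) =>
  p (x, y, z)

/-- View `X` as the first variable and `(Y,Z)` as the conditioning variable. -/
noncomputable def jointX_YZ (p : X × Y × Z → ℝ) : X × (Y × Z) → ℝ := fun (x, yz) =>
  p (x, yz.1, yz.2)

/-- The marginal of `p` on `Y × Z` (summing out `X`). -/
noncomputable def margX3 (p : X × Y × Z → ℝ) : Y × Z → ℝ := fun yz => ∑ x, p (x, yz.1, yz.2)

lemma margY_mul_sum_condXY_rpow {A B : Type*} [Fintype A] (q : A × B → ℝ) (hq : ∀ w, 0 ≤ q w)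
    {r : ℝ} (hr : 0 < r) (b : B) :
    margY q b * (∑ a, condXY q a b ^ r) ^ (1 / r) = (∑ a, q (a, b) ^ r) ^ (1 / r) := by
  have hm : 0 ≤ margY q b := Finset.sum_nonneg fun a _ => hq _
  rcases hm.eq_or_lt with h0 | hpos
  · have hz : ∀ a, q (a, b) = 0 := fun a =>
      (Finset.sum_eq_zero_iff_of_nonneg fun a _ => hq (a, b)).1 h0.symm a (Finset.mem_univ a)
    simp [← h0, hz, Real.zero_rpow hr.ne', Real.zero_rpow (inv_pos.2 hr).ne']
  · have hS : 0 ≤ ∑ a, q (a, b) ^ r := Finset.sum_nonneg fun a _ => Real.rpow_nonneg (hq _) _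
    have hsum : ∑ a, condXY q a b ^ r = (∑ a, q (a, b) ^ r) / margY q b ^ r := by
      rw [Finset.sum_div]
      exact Finset.sum_congr rfl fun a _ => Real.div_rpow (hq _) hm r
    rw [hsum, Real.div_rpow hS (Real.rpow_nonneg hm r), ← Real.rpow_mul hm,
      mul_one_div_cancel hr.ne', Real.rpow_one, mul_div_cancel₀ _ hpos.ne']

omit [Fintype Z] in
lemma margZ3_nonneg {p : X × Y × Z → ℝ} (hp : ∀ w, 0 ≤ p w) (z : Z) : 0 ≤ margZ3 p z :=
  Finset.sum_nonneg fun _ _ => Finset.sum_nonneg fun _ _ => hp _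

omit [Fintype Z] in
lemma cond3_nonneg {p : X × Y × Z → ℝ} (hp : ∀ w, 0 ≤ p w) (x : X) (y : Y) (z : Z) :
    0 ≤ cond3 p x y z :=
  div_nonneg (hp _) (margZ3_nonneg hp z)

omit [Fintype Z] in
lemma margZ3_pos {p : X × Y × Z → ℝ} (hp : ∀ w, 0 ≤ p w) {x : X} {y : Y} {z : Z}
    (h : 0 < p (x, y, z)) : 0 < margZ3 p z :=
  Finset.sum_pos' (fun _ _ => Finset.sum_nonneg fun _ _ => hp _)
    ⟨x, Finset.mem_univ x, Finset.sum_pos' (fun _ _ => hp _) ⟨y, Finset.mem_univ y, h⟩⟩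

lemma IsPMF.exists_pos {A : Type*} [Fintype A] {p : A → ℝ} (hp : IsPMF p) : ∃ w, 0 < p w := by
  by_contra! h
  have := Finset.sum_nonpos fun w (_ : w ∈ Finset.univ) => h w
  linarith [hp.2]

omit [Fintype Z] in
lemma margY_jointXY_Z (p : X × Y × Z → ℝ) (z : Z) : margY (jointXY_Z p) z = margZ3 p z :=
  Fintype.sum_prod_type _

omit [Fintype Z] in
lemma margY_margX3 (p : X × Y × Z → ℝ) (z : Z) : margY (margX3 p) z = margZ3 p z :=
  Finset.sum_comm

omit [Fintype Z] in
lemma condXY_margX3 (p : X × Y × Z → ℝ) (y : Y) (z : Z) :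
    condXY (margX3 p) y z = ∑ x, cond3 p x y z := by
  simp only [condXY, cond3, margY_margX3, margX3, Finset.sum_div]

/-- The normalizing constant of the tilted pmf `tilt3 α p`. -/
noncomputable def tiltNorm (α : ℝ) (p : X × Y × Z → ℝ) : ℝ :=
  ∑ w : X × Y × Z, margZ3 p w.2.2 * cond3 p w.1 w.2.1 w.2.2 ^ α

lemma tiltNorm_pos (α : ℝ) {p : X × Y × Z → ℝ} (hp : IsPMF p) : 0 < tiltNorm α p := by
  obtain ⟨⟨x, y, z⟩, hw⟩ := hp.exists_pos
  have hm := margZ3_pos hp.1 hw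
  exact Finset.sum_pos'
    (fun w _ => mul_nonneg (margZ3_nonneg hp.1 _) (Real.rpow_nonneg (cond3_nonneg hp.1 _ _ _) _))
    ⟨(x, y, z), Finset.mem_univ _, mul_pos hm (Real.rpow_pos_of_pos (div_pos hw hm) _)⟩

lemma HH_jointXY_Z (α : ℝ) (p : X × Y × Z → ℝ) :
    HH α (jointXY_Z p) = 1 / (1 - α) * Real.log (tiltNorm α p) := by
  have h : ∑ z, margY (jointXY_Z p) z * ∑ w, condXY (jointXY_Z p) w z ^ α = tiltNorm α p := by
    simp only [tiltNorm, Fintype.sum_prod_type, condXY, margY_jointXY_Z, Finset.mul_sum]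
    rw [Finset.sum_comm]
    refine Finset.sum_congr rfl fun x _ => ?_
    rw [Finset.sum_comm]
    rfl
  rw [HH, h]

lemma HH_margX3 (α : ℝ) (p : X × Y × Z → ℝ) :
    HH α (margX3 p) =
      1 / (1 - α) * Real.log (∑ yz : Y × Z, margZ3 p yz.2 * (∑ x, cond3 p x yz.1 yz.2) ^ α) := by
  simp only [HH, margY_margX3, condXY_margX3, Finset.mul_sum, Fintype.sum_prod_type_right]

lemma sum_margZ3_mul_rpow_pos (α : ℝ) {p : X × Y × Z → ℝ} (hp : IsPMF p) :
    0 < ∑ yz : Y × Z, margZ3 p yz.2 * (∑ x, cond3 p x yz.1 yz.2) ^ α := by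
  obtain ⟨⟨x, y, z⟩, hw⟩ := hp.exists_pos
  have hm := margZ3_pos hp.1 hw
  have hc : ∀ y z, 0 ≤ ∑ x, cond3 p x y z :=
    fun y z => Finset.sum_nonneg fun x _ => cond3_nonneg hp.1 x y z
  have hs : 0 < ∑ x, cond3 p x y z := Finset.sum_pos' (fun _ _ => cond3_nonneg hp.1 _ _ _)
    ⟨x, Finset.mem_univ x, div_pos hw hm⟩
  exact Finset.sum_pos' (fun _ _ => mul_nonneg (margZ3_nonneg hp.1 _) (Real.rpow_nonneg (hc _ _) _))
    ⟨(y, z), Finset.mem_univ _, mul_pos hm (Real.rpow_pos_of_pos hs _)⟩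

lemma tilt3_nonneg (α : ℝ) {p : X × Y × Z → ℝ} (hp : IsPMF p) (w : X × Y × Z) :
    0 ≤ tilt3 α p w :=
  div_nonneg (mul_nonneg (margZ3_nonneg hp.1 _) (Real.rpow_nonneg (cond3_nonneg hp.1 _ _ _) _))
    (tiltNorm_pos α hp).le

lemma sum_tilt3_rpow {α : ℝ} (hα : 0 < α) {p : X × Y × Z → ℝ} (hp : IsPMF p) (y : Y) (z : Z) :
    (∑ x, tilt3 α p (x, y, z) ^ (1 / α)) ^ α =
      margZ3 p z * (∑ x, cond3 p x y z) ^ α / tiltNorm α p := by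
  have hD := (tiltNorm_pos α hp).le
  have hm := margZ3_nonneg hp.1 z
  have hk : 0 ≤ margZ3 p z / tiltNorm α p := div_nonneg hm hD
  have hterm : ∀ x, tilt3 α p (x, y, z) ^ (1 / α) =
      (margZ3 p z / tiltNorm α p) ^ (1 / α) * cond3 p x y z := fun x => by
    have hc := cond3_nonneg hp.1 x y z
    have h : tilt3 α p (x, y, z) = margZ3 p z / tiltNorm α p * cond3 p x y z ^ α :=
      mul_div_right_comm _ _ _
    rw [h, Real.mul_rpow hk (Real.rpow_nonneg hc _), ← Real.rpow_mul hc,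
      mul_one_div_cancel hα.ne', Real.rpow_one]
  simp only [hterm]
  rw [← Finset.mul_sum, Real.mul_rpow (Real.rpow_nonneg hk _)
    (Finset.sum_nonneg fun x _ => cond3_nonneg hp.1 x y z), ← Real.rpow_mul hk,
    one_div_mul_cancel hα.ne', Real.rpow_one, div_mul_eq_mul_div]

lemma HA_jointX_YZ_tilt3 {α : ℝ} (hα : 0 < α) {p : X × Y × Z → ℝ} (hp : IsPMF p) :
    HA (1 / α) (jointX_YZ (tilt3 α p)) = 1 / α / (1 - 1 / α) *
      Real.log ((∑ yz : Y × Z, margZ3 p yz.2 * (∑ x, cond3 p x yz.1 yz.2) ^ α) /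
        tiltNorm α p) := by
  rw [HA, Finset.sum_div]
  congr 2
  refine Finset.sum_congr rfl fun yz _ => ?_
  rw [margY_mul_sum_condXY_rpow (jointX_YZ (tilt3 α p)) (fun _ => tilt3_nonneg α hp _)
    (one_div_pos.2 hα), one_div_one_div]
  exact sum_tilt3_rpow hα hp yz.1 yz.2

/-- **Classical Rényi chain rule**:
`H^H_α(XY|Z)_p = H^A_{1/α}(X|YZ)_{p̂} + H^H_α(Y|Z)_p`. -/
theorem renyi_chain_rule (p : X × Y × Z → ℝ) (hp : IsPMF p)
    (α : ℝ) (hα0 : 0 < α) (hα1 : α ≠ 1) :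
    HH α (jointXY_Z p) =
      HA (1 / α) (jointX_YZ (tilt3 α p)) + HH α (margX3 p) := by
  have hα : 1 / α / (1 - 1 / α) = -(1 / (1 - α)) := by
    have h1 : 1 - α ≠ 0 := sub_ne_zero.2 hα1.symm
    have h2 : α - 1 ≠ 0 := sub_ne_zero.2 hα1
    have h3 : 1 - 1 / α = (α - 1) / α := by field_simp
    rw [h3]
    field_simp
    ring
  rw [HH_jointXY_Z, HA_jointX_YZ_tilt3 hα0 hp, HH_margX3,
    Real.log_div (sum_margZ3_mul_rpow_pos α hp).ne' (tiltNorm_pos α hp).ne', hα]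
  ring
end

section
/- Let p1, p2 be probability mass functions on {0,1}×𝒴1 and {0,1}×𝒴2 respectively, and α∈(0,∞) with α≠1. Define the tilted pmfs p̄_i(x,y) = p_i(x|y)^α p_i(y) / ∑_{x',y'} p_i(x'|y')^α p_i(y'). Then H^H_α(X_i|Y_i)_{p_i} = H^A_{1/α}(X_i|Y_i)_{p̄_i} for i=1,2, and H^H_α(X_1|Y_1)_{p_1} + H^H_α(X_2|Y_2)_{p_2} = H^A_{1/α}(X_2|(X_1⊕X_2)Y_1Y_2)_{q̄} + H^H_α(X_1⊕X_2|Y_1Y_2)_q, where q is the combined distribution of p1,p2 and q̄ is the combined distribution of p̄1,p̄2. -/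
open Finset

/-- The tilted probability mass function `p̄`. -/
noncomputable def tilt {X Y : Type*} [Fintype X] [Fintype Y] (α : ℝ) (p : X × Y → ℝ) :
    X × Y → ℝ := fun (x, y) =>
  condXY p x y ^ α * margY p y / ∑ xy : X × Y, condXY p xy.1 xy.2 ^ α * margY p xy.2

variable {Y1 Y2 : Type*} [Fintype Y1] [Fintype Y2]

/-- The joint distribution of `Z = X₁ ⊕ X₂` and the side information `(Y₁, Y₂)` under the
combined distribution `q(z,x₂,y₁,y₂) = p₁(z ⊕ x₂, y₁) p₂(x₂, y₂)`. -/
noncomputable def combinedZ (p1 : ZMod 2 × Y1 → ℝ) (p2 : ZMod 2 × Y2 → ℝ) :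
    ZMod 2 × (Y1 × Y2) → ℝ := fun zy => ∑ x2 : ZMod 2, p1 (zy.1 + x2, zy.2.1) * p2 (x2, zy.2.2)

/-- The joint distribution of `X₂` and `(Z = X₁ ⊕ X₂, Y₁, Y₂)` under the combined
distribution `q(z,x₂,y₁,y₂) = p₁(z ⊕ x₂, y₁) p₂(x₂, y₂)`. -/
noncomputable def combinedX2 (p1 : ZMod 2 × Y1 → ℝ) (p2 : ZMod 2 × Y2 → ℝ) :
    ZMod 2 × (ZMod 2 × Y1 × Y2) → ℝ := fun xw =>
  p1 (xw.2.1 + xw.1, xw.2.2.1) * p2 (xw.1, xw.2.2.2)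

/-- The sum `∑ y, p(y) ∑ x, p(x|y)^α` inside the logarithm of the Hayashi entropy. -/
noncomputable def hayashiSum {X Y : Type*} [Fintype X] [Fintype Y] (α : ℝ) (p : X × Y → ℝ) : ℝ :=
  ∑ y, margY p y * ∑ x, condXY p x y ^ α

section Tilting

variable {X Y : Type*} [Fintype X]

theorem margY_nonneg {p : X × Y → ℝ} (hp : ∀ ω, 0 ≤ p ω) (y : Y) : 0 ≤ margY p y :=
  sum_nonneg fun _ _ => hp _

theorem condXY_nonneg {p : X × Y → ℝ} (hp : ∀ ω, 0 ≤ p ω) (x : X) (y : Y) : 0 ≤ condXY p x y :=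
  div_nonneg (hp _) (margY_nonneg hp y)

theorem sum_condXY {p : X × Y → ℝ} {y : Y} (hy : margY p y ≠ 0) : ∑ x, condXY p x y = 1 := by
  simp only [condXY, ← sum_div]
  exact div_self hy

variable [Fintype Y]

theorem sum_margY (p : X × Y → ℝ) : ∑ y, margY p y = ∑ ω, p ω := by
  rw [Fintype.sum_prod_type_right]
  rfl

theorem hayashiSum_nonneg {p : X × Y → ℝ} (hp : ∀ ω, 0 ≤ p ω) (α : ℝ) : 0 ≤ hayashiSum α p :=
  sum_nonneg fun y _ => mul_nonneg (margY_nonneg hp y)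
    (sum_nonneg fun x _ => Real.rpow_nonneg (condXY_nonneg hp x y) α)

theorem hayashiSum_pos {p : X × Y → ℝ} (hp : IsPMF p) (α : ℝ) : 0 < hayashiSum α p := by
  obtain ⟨⟨x, y⟩, -, hxy⟩ : ∃ ω ∈ univ, p ω ≠ 0 := exists_ne_zero_of_sum_ne_zero (by simp [hp.2])
  have hpos : 0 < p (x, y) := (hp.1 _).lt_of_ne' hxy
  have hm : 0 < margY p y :=
    hpos.trans_le (single_le_sum (f := fun x => p (x, y)) (fun _ _ => hp.1 _) (mem_univ x))
  have hc (y : Y) : ∀ x ∈ univ, 0 ≤ condXY p x y ^ α := fun x _ =>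
    Real.rpow_nonneg (condXY_nonneg hp.1 x y) α
  refine sum_pos' (fun y _ => mul_nonneg (margY_nonneg hp.1 y) (sum_nonneg (hc y)))
    ⟨y, mem_univ y, mul_pos hm (sum_pos' (hc y) ⟨x, mem_univ x, ?_⟩)⟩
  exact Real.rpow_pos_of_pos (div_pos hpos hm) α

theorem HA_one_div {p : X × Y → ℝ} (hp : ∀ ω, 0 ≤ p ω) {α : ℝ} (hα : 0 < α) :
    HA (1 / α) p = -(1 / (1 - α)) * Real.log (∑ y, (∑ x, p (x, y) ^ (1 / α)) ^ α) := by
  have hcoef : 1 / α / (1 - 1 / α) = -(1 / (1 - α)) := by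
    rw [div_div, mul_sub, mul_one, mul_one_div_cancel hα.ne', ← neg_sub 1 α, div_neg]
  rw [HA, hcoef]
  congr 2
  refine sum_congr rfl fun y _ => ?_
  have hm := margY_nonneg hp y
  simp only [condXY, one_div_one_div, Real.div_rpow (hp _) hm, ← sum_div]
  rw [Real.div_rpow (sum_nonneg fun x _ => Real.rpow_nonneg (hp _) _) (Real.rpow_nonneg hm _),
    ← Real.rpow_mul hm, one_div_mul_cancel hα.ne', Real.rpow_one]
  rcases hm.eq_or_lt with h | h
  · have hz (x : X) : p (x, y) = 0 :=
      (sum_eq_zero_iff_of_nonneg fun _ _ => hp _).1 h.symm x (mem_univ x)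
    simp [hz, hα.ne']
  · exact mul_div_cancel₀ _ h.ne'

theorem tilt_apply (α : ℝ) (p : X × Y → ℝ) (x : X) (y : Y) :
    tilt α p (x, y) = condXY p x y ^ α * (margY p y / hayashiSum α p) := by
  have h : ∑ xy : X × Y, condXY p xy.1 xy.2 ^ α * margY p xy.2 = hayashiSum α p := by
    rw [Fintype.sum_prod_type_right]
    simp only [hayashiSum, mul_sum, mul_comm]
  rw [tilt, h, mul_div_assoc]

theorem tilt_nonneg {p : X × Y → ℝ} (hp : ∀ ω, 0 ≤ p ω) (α : ℝ) (ω : X × Y) :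
    0 ≤ tilt α p ω := by
  obtain ⟨x, y⟩ := ω
  rw [tilt_apply]
  exact mul_nonneg (Real.rpow_nonneg (condXY_nonneg hp x y) α)
    (div_nonneg (margY_nonneg hp y) (hayashiSum_nonneg hp α))

theorem tilt_rpow_one_div {p : X × Y → ℝ} (hp : ∀ ω, 0 ≤ p ω) {α : ℝ} (hα : 0 < α)
    (x : X) (y : Y) :
    tilt α p (x, y) ^ (1 / α) = condXY p x y * (margY p y / hayashiSum α p) ^ (1 / α) := by
  have hc := condXY_nonneg hp x y
  rw [tilt_apply, Real.mul_rpow (Real.rpow_nonneg hc α)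
    (div_nonneg (margY_nonneg hp y) (hayashiSum_nonneg hp α)), ← Real.rpow_mul hc,
    mul_one_div_cancel hα.ne', Real.rpow_one]

/-- The Hayashi entropy is the Arimoto entropy of the dual order of the tilted distribution. -/
theorem HH_eq_HA_tilt {p : X × Y → ℝ} (hp : IsPMF p) {α : ℝ} (hα : 0 < α) :
    HH α p = HA (1 / α) (tilt α p) := by
  have h : ∑ y, (∑ x, tilt α p (x, y) ^ (1 / α)) ^ α = (hayashiSum α p)⁻¹ := by
    calc _ = ∑ y, margY p y / hayashiSum α p := sum_congr rfl fun y _ => by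
          have hd := div_nonneg (margY_nonneg hp.1 y) (hayashiSum_nonneg hp.1 α)
          simp only [tilt_rpow_one_div hp.1 hα, ← sum_mul]
          rw [Real.mul_rpow (sum_nonneg fun x _ => condXY_nonneg hp.1 x y)
            (Real.rpow_nonneg hd _), ← Real.rpow_mul hd, one_div_mul_cancel hα.ne', Real.rpow_one]
          by_cases hy : margY p y = 0
          · simp [hy]
          · rw [sum_condXY hy, Real.one_rpow, one_mul]
      _ = _ := by rw [← sum_div, sum_margY, hp.2, one_div]
  rw [HA_one_div (tilt_nonneg hp.1 α) hα, h, Real.log_inv, neg_mul_neg]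
  rfl

end Tilting

theorem margY_combinedZ {Y1 Y2 : Type*} (p1 : ZMod 2 × Y1 → ℝ) (p2 : ZMod 2 × Y2 → ℝ)
    (y : Y1 × Y2) : margY (combinedZ p1 p2) y = margY p1 y.1 * margY p2 y.2 := by
  simp only [margY, combinedZ]
  rw [sum_comm, mul_sum]
  refine sum_congr rfl fun x _ => ?_
  rw [← sum_mul]
  congr 1
  exact Equiv.sum_comp (Equiv.addRight x) fun z => p1 (z, y.1)

theorem isPMF_combinedZ {p1 : ZMod 2 × Y1 → ℝ} {p2 : ZMod 2 × Y2 → ℝ}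
    (hp1 : IsPMF p1) (hp2 : IsPMF p2) : IsPMF (combinedZ p1 p2) := by
  refine ⟨fun _ => sum_nonneg fun _ _ => mul_nonneg (hp1.1 _) (hp2.1 _), ?_⟩
  rw [← sum_margY, Fintype.sum_prod_type]
  simp only [margY_combinedZ, ← mul_sum, sum_margY, hp1.2, hp2.2, mul_one]

theorem condXY_combinedZ {Y1 Y2 : Type*} (p1 : ZMod 2 × Y1 → ℝ) (p2 : ZMod 2 × Y2 → ℝ)
    (z : ZMod 2) (y : Y1 × Y2) :
    condXY (combinedZ p1 p2) z y = ∑ x, condXY p1 (z + x) y.1 * condXY p2 x y.2 := by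
  simp only [condXY, margY_combinedZ, div_mul_div_comm, ← sum_div]
  rfl

theorem sum_combinedX2_tilt_rpow {p1 : ZMod 2 × Y1 → ℝ} {p2 : ZMod 2 × Y2 → ℝ}
    (hp1 : ∀ ω, 0 ≤ p1 ω) (hp2 : ∀ ω, 0 ≤ p2 ω) {α : ℝ} (hα : 0 < α) :
    ∑ w, (∑ x, combinedX2 (tilt α p1) (tilt α p2) (x, w) ^ (1 / α)) ^ α =
      hayashiSum α (combinedZ p1 p2) / (hayashiSum α p1 * hayashiSum α p2) := by
  rw [Fintype.sum_prod_type_right, hayashiSum, sum_div]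
  refine sum_congr rfl fun y _ => ?_
  rw [mul_div_right_comm, mul_sum]
  refine sum_congr rfl fun z _ => ?_
  have hd1 := div_nonneg (margY_nonneg hp1 y.1) (hayashiSum_nonneg hp1 α)
  have hd2 := div_nonneg (margY_nonneg hp2 y.2) (hayashiSum_nonneg hp2 α)
  simp only [combinedX2, Real.mul_rpow (tilt_nonneg hp1 α _) (tilt_nonneg hp2 α _),
    tilt_rpow_one_div hp1 hα, tilt_rpow_one_div hp2 hα, mul_mul_mul_comm, ← sum_mul,
    ← Real.mul_rpow hd1 hd2]
  rw [Real.mul_rpow (sum_nonneg fun x _ => mul_nonneg (condXY_nonneg hp1 _ _)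
      (condXY_nonneg hp2 _ _)) (Real.rpow_nonneg (mul_nonneg hd1 hd2) _),
    ← Real.rpow_mul (mul_nonneg hd1 hd2), one_div_mul_cancel hα.ne', Real.rpow_one,
    condXY_combinedZ, margY_combinedZ, div_mul_div_comm, mul_comm]

/-- **Information combining chain rule (classical)**. -/
theorem information_combining_chain_rule
    (p1 : ZMod 2 × Y1 → ℝ) (p2 : ZMod 2 × Y2 → ℝ) (hp1 : IsPMF p1) (hp2 : IsPMF p2)
    (α : ℝ) (hα0 : 0 < α) (hα1 : α ≠ 1) :
    HH α p1 = HA (1 / α) (tilt α p1) ∧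
    HH α p2 = HA (1 / α) (tilt α p2) ∧
    HH α p1 + HH α p2 =
      HA (1 / α) (combinedX2 (tilt α p1) (tilt α p2)) + HH α (combinedZ p1 p2) := by
  refine ⟨HH_eq_HA_tilt hp1 hα0, HH_eq_HA_tilt hp2 hα0, ?_⟩
  have h1 := (hayashiSum_pos hp1 α).ne'
  have h2 := (hayashiSum_pos hp2 α).ne'
  have hnonneg (ω) : 0 ≤ combinedX2 (tilt α p1) (tilt α p2) ω :=
    mul_nonneg (tilt_nonneg hp1.1 α _) (tilt_nonneg hp2.1 α _)
  rw [HA_one_div hnonneg hα0,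
    sum_combinedX2_tilt_rpow hp1.1 hp2.1 hα0,
    Real.log_div (hayashiSum_pos (isPMF_combinedZ hp1 hp2) α).ne' (mul_ne_zero h1 h2),
    Real.log_mul h1 h2]
  change 1 / (1 - α) * Real.log (hayashiSum α p1) + 1 / (1 - α) * Real.log (hayashiSum α p2) =
    _ + 1 / (1 - α) * Real.log (hayashiSum α (combinedZ p1 p2))
  ring
end

section
/- Let p1, p2 be probability mass functions on {0,1}×𝒴1 and {0,1}×𝒴2 respectively, let q be their combined distribution, and let α∈(0,1/3]∪[1/2,1)∪(1,∞). Let a1,a2∈[0,1/2] satisfy h_{1/α}(a_i) = H^A_α(X_i|Y_i)_{p_i} for i=1,2. Then H^A_α(X_2|(X_1⊕X_2)Y_1Y_2)_q ≤ H^A_α(X_1|Y_1)_{p_1} + H^A_α(X_2|Y_2)_{p_2} − h_{1/α}(a1(1−a2)+a2(1−a1)). For α∈[1/3,1/2] the same holds with ≤ replaced by ≥, and for α∈{1/3,1/2} it holds with equality. -/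
open Finset

variable {Y1 Y2 : Type*} [Fintype Y1] [Fintype Y2]

/-- Binary Rényi entropy `h_α(t)`. -/
noncomputable def binEnt (α : ℝ) (t : ℝ) : ℝ :=
  (1 / (1 - α)) * Real.log (t ^ α + (1 - t) ^ α)

/-- The slope of the logarithm of `sinh (a x) / sinh (b x)` has a constant sign. -/
lemma sinh_mul_cosh_sub_nonneg {δ a b u : ℝ} (h : 0 ≤ δ * (a * b * (b ^ 2 - a ^ 2)))
    (hu : 0 ≤ u) :
    0 ≤ δ * (b * (Real.sinh (a * u) * Real.cosh (b * u))
      - a * (Real.cosh (a * u) * Real.sinh (b * u))) := by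
  have hd : ∀ x, HasDerivAt (fun u => δ * (b * (Real.sinh (a * u) * Real.cosh (b * u))
      - a * (Real.cosh (a * u) * Real.sinh (b * u))))
      (δ * ((b ^ 2 - a ^ 2) * (Real.sinh (a * x) * Real.sinh (b * x)))) x := by
    intro x
    have ha : HasDerivAt (fun u : ℝ => a * u) a x := by
      simpa using (hasDerivAt_id x).const_mul a
    have hb : HasDerivAt (fun u : ℝ => b * u) b x := by
      simpa using (hasDerivAt_id x).const_mul b
    refine ((((ha.sinh.fun_mul hb.cosh).const_mul b).fun_sub
      ((ha.cosh.fun_mul hb.sinh).const_mul a)).const_mul δ).congr_deriv ?_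
    ring
  have hsinh : ∀ y : ℝ, ∃ c, 0 ≤ c ∧ Real.sinh y = y * c := by
    intro y
    rcases eq_or_ne y 0 with rfl | hy
    · exact ⟨0, le_rfl, by simp⟩
    · refine ⟨Real.sinh y / y, ?_, by field_simp⟩
      rcases le_total 0 y with h0 | h0
      · exact div_nonneg (Real.sinh_nonneg_iff.2 h0) h0
      · exact div_nonneg_of_nonpos (Real.sinh_nonpos_iff.2 h0) h0
  have hmono := monotoneOn_of_hasDerivWithinAt_nonneg (convex_Ici (0 : ℝ))
    (fun x _ => (hd x).continuousAt.continuousWithinAt)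
    (fun x _ => (hd x).hasDerivWithinAt) (fun x _ => by
      obtain ⟨c, hc, hca⟩ := hsinh (a * x)
      obtain ⟨d, hd, hdb⟩ := hsinh (b * x)
      rw [hca, hdb]
      have : 0 ≤ δ * (a * b * (b ^ 2 - a ^ 2)) * (x ^ 2 * c * d) := by positivity
      linarith)
  simpa using hmono (Set.mem_Ici.2 le_rfl) (Set.mem_Ici.2 hu) hu

lemma sinh_mul_sinh_sub_nonneg {δ a b u v : ℝ} (hb : b ≠ 0)
    (h : 0 ≤ δ * (a * b * (b ^ 2 - a ^ 2))) (hu : 0 < u) (huv : u ≤ v) :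
    0 ≤ δ * (Real.sinh (a * u) * Real.sinh (b * v) - Real.sinh (a * v) * Real.sinh (b * u)) := by
  have hne : ∀ x, 0 < x → Real.sinh (b * x) ≠ 0 := fun x hx => by
    simp [hb, hx.ne']
  have hd : ∀ x, 0 < x → HasDerivAt (fun u => δ * (Real.sinh (a * u) / Real.sinh (b * u)))
      (δ * ((Real.cosh (a * x) * a * Real.sinh (b * x)
        - Real.sinh (a * x) * (Real.cosh (b * x) * b)) / Real.sinh (b * x) ^ 2)) x := by
    intro x hx
    have ha : HasDerivAt (fun u : ℝ => a * u) a x := by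
      simpa using (hasDerivAt_id x).const_mul a
    have hb : HasDerivAt (fun u : ℝ => b * u) b x := by
      simpa using (hasDerivAt_id x).const_mul b
    exact (ha.sinh.fun_div hb.sinh (hne x hx)).const_mul δ
  have hanti := antitoneOn_of_hasDerivWithinAt_nonpos (convex_Ioi (0 : ℝ))
    (fun x hx => (hd x hx).continuousAt.continuousWithinAt)
    (fun x hx => (hd x (by simpa using hx)).hasDerivWithinAt) (fun x hx => by
      rw [interior_Ioi] at hx
      have := sinh_mul_cosh_sub_nonneg h (le_of_lt hx)
      rw [← mul_div_assoc]
      exact div_nonpos_of_nonpos_of_nonneg (by linarith) (sq_nonneg _))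
  have hle := hanti (Set.mem_Ioi.2 hu) (Set.mem_Ioi.2 (hu.trans_le huv)) huv
  have hpos : 0 < Real.sinh (b * u) * Real.sinh (b * v) := by
    rcases lt_or_gt_of_ne hb with hb | hb
    · exact mul_pos_of_neg_of_neg (Real.sinh_neg_iff.2 (by nlinarith))
        (Real.sinh_neg_iff.2 (by nlinarith))
    · exact mul_pos (Real.sinh_pos_iff.2 (by nlinarith)) (Real.sinh_pos_iff.2 (by nlinarith))
  have h1 := hne u hu
  have h2 := hne v (hu.trans_le huv)
  have heq : δ * (Real.sinh (a * u) * Real.sinh (b * v) - Real.sinh (a * v) * Real.sinh (b * u))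
      = (δ * (Real.sinh (a * u) / Real.sinh (b * u))
        - δ * (Real.sinh (a * v) / Real.sinh (b * v)))
        * (Real.sinh (b * u) * Real.sinh (b * v)) := by
    field_simp
  rw [heq]
  exact mul_nonneg (sub_nonneg.2 hle) hpos.le

/-- The unnormalised sum of the `s`-th powers of a binary distribution with bias `t`. -/
noncomputable def symmPow (s t : ℝ) : ℝ := (1 + t) ^ s + (1 - t) ^ s

/-- Up to a factor `k + 1`, the derivative of `symmPow (k + 1)`. -/
noncomputable def skewPow (k t : ℝ) : ℝ := (1 + t) ^ k - (1 - t) ^ k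

lemma hasDerivAt_one_add_rpow (k : ℝ) {t : ℝ} (h0 : 0 < t) :
    HasDerivAt (fun t : ℝ => (1 + t) ^ k) (k * (1 + t) ^ (k - 1)) t := by
  have h : HasDerivAt (fun t : ℝ => 1 + t) 1 t := (hasDerivAt_id t).const_add 1
  simpa using h.rpow_const (p := k) (Or.inl (by linarith))

lemma hasDerivAt_one_sub_rpow (k : ℝ) {t : ℝ} (h1 : t < 1) :
    HasDerivAt (fun t : ℝ => (1 - t) ^ k) (-(k * (1 - t) ^ (k - 1))) t := by
  have h : HasDerivAt (fun t : ℝ => 1 - t) (-1) t := (hasDerivAt_id t).const_sub 1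
  simpa using h.rpow_const (p := k) (Or.inl (by linarith))

lemma hasDerivAt_skewPow (k : ℝ) {t : ℝ} (h0 : 0 < t) (h1 : t < 1) :
    HasDerivAt (skewPow k) (k * symmPow (k - 1) t) t := by
  refine ((hasDerivAt_one_add_rpow k h0).fun_sub (hasDerivAt_one_sub_rpow k h1)).congr_deriv ?_
  simp only [symmPow]
  ring

lemma hasDerivAt_symmPow (s : ℝ) {t : ℝ} (h0 : 0 < t) (h1 : t < 1) :
    HasDerivAt (symmPow s) (s * skewPow (s - 1) t) t := by
  refine ((hasDerivAt_one_add_rpow s h0).fun_add (hasDerivAt_one_sub_rpow s h1)).congr_deriv ?_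
  simp only [skewPow]
  ring

lemma mul_skewPow_pos {k t : ℝ} (hk : k ≠ 0) (h0 : 0 < t) (h1 : t < 1) :
    0 < k * skewPow k t := by
  rcases lt_or_gt_of_ne hk with hk | hk
  · exact mul_pos_of_neg_of_neg hk (sub_neg.2
      (Real.rpow_lt_rpow_of_neg (by linarith) (by linarith) hk))
  · exact mul_pos hk (sub_pos.2 (Real.rpow_lt_rpow (by linarith) (by linarith) hk))

lemma skewPow_mul_skewPow_pos {k t t' : ℝ} (hk : k ≠ 0) (h0 : 0 < t) (h1 : t < 1)
    (h0' : 0 < t') (h1' : t' < 1) : 0 < skewPow k t * skewPow k t' := by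
  have := mul_pos (mul_skewPow_pos hk h0 h1) (mul_skewPow_pos hk h0' h1')
  have hk2 : 0 < k ^ 2 := by positivity
  nlinarith

/-- The substitution `t = tanh u`. -/
lemma exists_skewPow_eq_sinh {t : ℝ} (h0 : 0 < t) (h1 : t < 1) :
    ∃ c > 0, c ^ 2 = (1 + t) * (1 - t) ∧
      ∀ k, skewPow k t = 2 * c ^ k * Real.sinh (k * Real.artanh t) := by
  have hp : 0 < 1 + t := by linarith
  have hq : 0 < 1 - t := by linarith
  refine ⟨Real.exp ((Real.log (1 + t) + Real.log (1 - t)) / 2), Real.exp_pos _, ?_, fun k => ?_⟩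
  · rw [← Real.exp_nat_mul, Nat.cast_ofNat, mul_div_cancel₀ _ two_ne_zero, Real.exp_add,
      Real.exp_log hp, Real.exp_log hq]
  · rw [skewPow, Real.artanh_eq_half_log ⟨by linarith, h1.le⟩, Real.log_div hp.ne' hq.ne',
      Real.rpow_def_of_pos hp, Real.rpow_def_of_pos hq, ← Real.exp_mul, Real.sinh_eq,
      mul_div_assoc', mul_assoc, mul_div_cancel_left₀ _ two_ne_zero, mul_sub, ← Real.exp_add,
      ← Real.exp_add]
    congr 2 <;> ring

lemma two_mul_symmPow_sub_one {k t : ℝ} (h0 : 0 < t) (h1 : t < 1) :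
    2 * (t * symmPow (k - 1) t)
      = skewPow k t - (1 + t) * (1 - t) * skewPow (k - 2) t := by
  have hp : 0 < 1 + t := by linarith
  have hq : 0 < 1 - t := by linarith
  have e1 : ∀ z : ℝ, 0 < z → z ^ (k - 1) = z ^ (k - 2) * z := fun z hz => by
    rw [← Real.rpow_add_one hz.ne']; congr 1; ring
  have e2 : ∀ z : ℝ, 0 < z → z ^ k = z ^ (k - 2) * z * z := fun z hz => by
    rw [← Real.rpow_add_one hz.ne', ← Real.rpow_add_one hz.ne']; congr 1; ring
  simp only [symmPow, skewPow, e1 _ hp, e1 _ hq, e2 _ hp, e2 _ hq]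
  ring

/-- Comparison of the logarithmic derivatives of `skewPow k` at two points. -/
lemma skewPow_elasticity_le {δ k x y : ℝ} (hk : k ≠ 0) (h : 0 ≤ δ * ((k - 1) * (k - 2)))
    (hx : 0 < x) (hxy : x ≤ y) (hy : y < 1) :
    δ * (x * (k * symmPow (k - 1) x) * skewPow k y)
      ≤ δ * (y * (k * symmPow (k - 1) y) * skewPow k x) := by
  have hx1 : x < 1 := hxy.trans_lt hy
  have hy0 : 0 < y := hx.trans_le hxy
  have ex := two_mul_symmPow_sub_one (k := k) hx hx1
  have ey := two_mul_symmPow_sub_one (k := k) hy0 hy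
  obtain ⟨c, hc, hc2, hcs⟩ := exists_skewPow_eq_sinh hx hx1
  obtain ⟨d, hd, hd2, hds⟩ := exists_skewPow_eq_sinh hy0 hy
  have hS := sinh_mul_sinh_sub_nonneg (δ := δ * k) (a := k - 2) (b := k) hk
    (by
      have : 0 ≤ δ * ((k - 1) * (k - 2)) * (4 * k ^ 2) := by positivity
      linarith)
    (Real.artanh_pos ⟨hx, hx1⟩) (Real.artanh_le_artanh (by linarith) hy hxy)
  have key : ∀ z : ℝ, 0 < z → z ^ 2 * z ^ (k - 2) = z ^ k := fun z hz => by
    rw [← Real.rpow_natCast, ← Real.rpow_add hz]; congr 1; push_cast; ring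
  rw [← hc2, hcs (k - 2)] at ex
  rw [← hd2, hds (k - 2)] at ey
  have kc := key c hc
  have kd := key d hd
  have ex' : 2 * (x * symmPow (k - 1) x) = skewPow k x
      - 2 * c ^ k * Real.sinh ((k - 2) * Real.artanh x) := by
    rw [ex, ← kc]; ring
  have ey' : 2 * (y * symmPow (k - 1) y) = skewPow k y
      - 2 * d ^ k * Real.sinh ((k - 2) * Real.artanh y) := by
    rw [ey, ← kd]; ring
  have hfin : δ * (y * (k * symmPow (k - 1) y) * skewPow k x)
      - δ * (x * (k * symmPow (k - 1) x) * skewPow k y)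
      = 2 * c ^ k * d ^ k * (δ * k * (Real.sinh ((k - 2) * Real.artanh x)
        * Real.sinh (k * Real.artanh y)
        - Real.sinh ((k - 2) * Real.artanh y) * Real.sinh (k * Real.artanh x))) := by
    have e : ∀ A B P Q : ℝ, δ * (y * (k * A) * P) - δ * (x * (k * B) * Q)
      = δ * k / 2 * (2 * (y * A) * P - 2 * (x * B) * Q) := by intros; ring
    rw [e, ex', ey', hcs k, hds k]
    ring
  rw [← sub_nonneg, hfin]
  positivity

lemma skewPow_cross_le {δ k r x y : ℝ} (hk : k ≠ 0) (h : 0 ≤ δ * ((k - 1) * (k - 2)))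
    (hr0 : 0 < r) (hr1 : r ≤ 1) (hx : 0 < x) (hxy : x ≤ y) (hy : y < 1) :
    0 ≤ δ * (skewPow k (r * x) * skewPow k y - skewPow k (r * y) * skewPow k x) := by
  have hne : ∀ z, 0 < z → z < 1 → skewPow k z ≠ 0 := fun z hz hz1 =>
    right_ne_zero_of_mul (mul_skewPow_pos hk hz hz1).ne'
  have hrlt : ∀ z, 0 < z → z < 1 → r * z < 1 := fun z hz hz1 => by nlinarith
  have hd : ∀ z, 0 < z → z < 1 → HasDerivAt (fun z => δ * (skewPow k (r * z) / skewPow k z))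
      (δ * ((k * symmPow (k - 1) (r * z) * r * skewPow k z
        - skewPow k (r * z) * (k * symmPow (k - 1) z)) / skewPow k z ^ 2)) z := by
    intro z hz hz1
    have hm : HasDerivAt (fun z : ℝ => r * z) r z := by
      simpa using (hasDerivAt_id z).const_mul r
    have hc : HasDerivAt (fun z => skewPow k (r * z)) (k * symmPow (k - 1) (r * z) * r) z :=
      (hasDerivAt_skewPow k (mul_pos hr0 hz) (hrlt z hz hz1)).comp z hm
    exact (hc.fun_div (hasDerivAt_skewPow k hz hz1) (hne z hz hz1)).const_mul δ
  have hanti := antitoneOn_of_hasDerivWithinAt_nonpos (convex_Ioo (0 : ℝ) 1)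
    (fun z hz => (hd z hz.1 hz.2).continuousAt.continuousWithinAt)
    (fun z hz => by
      rw [interior_Ioo] at hz
      exact (hd z hz.1 hz.2).hasDerivWithinAt) (fun z hz => by
      rw [interior_Ioo] at hz
      have hel := skewPow_elasticity_le hk h (mul_pos hr0 hz.1)
        (mul_le_of_le_one_left hz.1.le hr1) hz.2
      rw [← mul_div_assoc]
      refine div_nonpos_of_nonpos_of_nonneg ?_ (sq_nonneg _)
      refine nonpos_of_mul_nonpos_right ?_ hz.1
      linarith)
  have hx1 := hxy.trans_lt hy
  have hy0 := hx.trans_le hxy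
  have hle := hanti ⟨hx, hx1⟩ ⟨hy0, hy⟩ hxy
  have h1 := hne x hx hx1
  have h2 := hne y hy0 hy
  have heq : δ * (skewPow k (r * x) * skewPow k y - skewPow k (r * y) * skewPow k x)
      = (δ * (skewPow k (r * x) / skewPow k x) - δ * (skewPow k (r * y) / skewPow k y))
        * (skewPow k x * skewPow k y) := by
    field_simp
  rw [heq]
  exact mul_nonneg (sub_nonneg.2 hle) (skewPow_mul_skewPow_pos hk hx hx1 hy0 hy).le

lemma continuous_symmPow {s : ℝ} (hs : 0 ≤ s) : Continuous (symmPow s) :=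
  ((continuous_const.add continuous_id).rpow_const fun _ => Or.inr hs).add
    ((continuous_const.sub continuous_id).rpow_const fun _ => Or.inr hs)

/-- `symmPow (k + 1) (r t)` lies on one side of its tangent as a function of
`symmPow (k + 1) t`. -/
lemma symmPow_tangent_le {δ k r t₀ t : ℝ} (hk : k ≠ 0) (hk1 : -1 < k)
    (h : 0 ≤ δ * ((k - 1) * (k - 2))) (hr0 : 0 < r) (hr1 : r ≤ 1)
    (ht₀ : 0 < t₀) (ht₀1 : t₀ < 1) (ht : 0 ≤ t) (ht1 : t ≤ 1) :
    δ * (symmPow (k + 1) (r * t) * skewPow k t₀ - r * skewPow k (r * t₀) * symmPow (k + 1) t)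
      ≤ δ * (symmPow (k + 1) (r * t₀) * skewPow k t₀
        - r * skewPow k (r * t₀) * symmPow (k + 1) t₀) := by
  set D : ℝ → ℝ := fun t => δ * (symmPow (k + 1) (r * t) * skewPow k t₀
    - r * skewPow k (r * t₀) * symmPow (k + 1) t) with hD
  have hcont : Continuous D := by
    have hc := continuous_symmPow (s := k + 1) (by linarith)
    have hc' : Continuous fun t => symmPow (k + 1) (r * t) := hc.comp (continuous_const_mul r)
    exact continuous_const.mul ((hc'.mul continuous_const).sub (continuous_const.mul hc))
  have hd : ∀ z, 0 < z → z < 1 → HasDerivAt D ((k + 1) * r * (δ *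
      (skewPow k (r * z) * skewPow k t₀ - skewPow k (r * t₀) * skewPow k z))) z := by
    intro z hz hz1
    have hm : HasDerivAt (fun z : ℝ => r * z) r z := by
      simpa using (hasDerivAt_id z).const_mul r
    have hc : HasDerivAt (fun z => symmPow (k + 1) (r * z))
        ((k + 1) * skewPow (k + 1 - 1) (r * z) * r) z :=
      (hasDerivAt_symmPow (k + 1) (mul_pos hr0 hz) (by nlinarith)).comp z hm
    refine (((hc.mul_const _).fun_sub
      ((hasDerivAt_symmPow (k + 1) hz hz1).const_mul _)).const_mul δ).congr_deriv ?_
    rw [add_sub_cancel_right]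
    ring
  have hkr : 0 ≤ (k + 1) * r := mul_nonneg (by linarith) hr0.le
  rcases le_total t t₀ with htt | htt
  · exact monotoneOn_of_hasDerivWithinAt_nonneg (convex_Icc 0 t₀) hcont.continuousOn
      (fun z hz => by
        rw [interior_Icc] at hz
        exact (hd z hz.1 (hz.2.trans ht₀1)).hasDerivWithinAt)
      (fun z hz => by
        rw [interior_Icc] at hz
        exact mul_nonneg hkr (skewPow_cross_le hk h hr0 hr1 hz.1 hz.2.le ht₀1))
      ⟨ht, htt⟩ ⟨ht₀.le, le_rfl⟩ htt
  · exact antitoneOn_of_hasDerivWithinAt_nonpos (convex_Icc t₀ 1) hcont.continuousOn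
      (fun z hz => by
        rw [interior_Icc] at hz
        exact (hd z (ht₀.trans hz.1) hz.2).hasDerivWithinAt)
      (fun z hz => by
        rw [interior_Icc] at hz
        have := skewPow_cross_le hk h hr0 hr1 ht₀ hz.1.le hz.2
        exact mul_nonpos_of_nonneg_of_nonpos hkr (by linarith))
      ⟨le_rfl, ht₀1.le⟩ ⟨htt, ht1⟩ htt

lemma symmPow_abs (s t : ℝ) : symmPow s |t| = symmPow s t := by
  rcases abs_choice t with h | h <;> rw [h]
  rw [symmPow, symmPow, sub_neg_eq_add, ← sub_eq_add_neg, add_comm]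

lemma mul_symmPow_strictMonoOn {k : ℝ} (hk : k ≠ 0) (hk1 : -1 < k) :
    StrictMonoOn (fun t => k * symmPow (k + 1) t) (Set.Icc 0 1) := by
  refine strictMonoOn_of_hasDerivWithinAt_pos (convex_Icc 0 1)
    (continuous_const.mul (continuous_symmPow (by linarith))).continuousOn
    (fun z hz => by
      rw [interior_Icc] at hz
      exact ((hasDerivAt_symmPow (k + 1) hz.1 hz.2).const_mul k).hasDerivWithinAt)
    (fun z hz => by
      rw [interior_Icc] at hz
      have h1 := mul_skewPow_pos hk hz.1 hz.2
      have h2 : 0 < k + 1 := by linarith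
      rw [add_sub_cancel_right, mul_left_comm]
      positivity)

/-- Jensen's inequality for `symmPow (k + 1) (r t)` as a function of `symmPow (k + 1) t`. -/
lemma sum_symmPow_mul_le {ι : Type*} [Fintype ι] {δ k r t₀ : ℝ} (w t : ι → ℝ)
    (hk : k ≠ 0) (hk1 : -1 < k) (h : 0 ≤ δ * ((k - 1) * (k - 2)))
    (hw : ∀ i, 0 ≤ w i) (ht : ∀ i, |t i| ≤ 1) (hr : |r| ≤ 1) (ht₀ : |t₀| ≤ 1)
    (heq : ∑ i, w i * symmPow (k + 1) (t i) = (∑ i, w i) * symmPow (k + 1) t₀) :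
    δ * k * ∑ i, w i * symmPow (k + 1) (t i * r)
      ≤ δ * k * ((∑ i, w i) * symmPow (k + 1) (t₀ * r)) := by
  wlog hnn : (∀ i, 0 ≤ t i) ∧ 0 ≤ r ∧ 0 ≤ t₀ generalizing t r t₀
  · have := this (r := |r|) (t₀ := |t₀|) (fun i => |t i|) (by simpa using ht) (by simpa using hr)
      (by simpa using ht₀) (by simpa only [symmPow_abs] using heq)
      ⟨fun i => abs_nonneg _, abs_nonneg _, abs_nonneg _⟩
    simpa only [← abs_mul, symmPow_abs] using this
  obtain ⟨htn, hrn, ht₀n⟩ := hnn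
  simp only [abs_of_nonneg (htn _)] at ht
  rw [abs_of_nonneg hrn] at hr
  rw [abs_of_nonneg ht₀n] at ht₀
  have hmono := mul_symmPow_strictMonoOn hk hk1
  have hsum0 : ∑ i, w i * (k * symmPow (k + 1) (t i) - k * symmPow (k + 1) t₀) = 0 := by
    simp only [mul_sub, sum_sub_distrib, mul_left_comm _ k]
    rw [← mul_sum, ← mul_sum, heq, sum_mul, sub_self]
  have hdeg : (∀ i, w i * (k * symmPow (k + 1) (t i) - k * symmPow (k + 1) t₀) = 0) →
      δ * k * ∑ i, w i * symmPow (k + 1) (t i * r)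
        ≤ δ * k * ((∑ i, w i) * symmPow (k + 1) (t₀ * r)) := fun hall => by
    refine le_of_eq ?_
    rw [sum_mul]
    congr 1
    refine sum_congr rfl fun i _ => ?_
    rcases mul_eq_zero.1 (hall i) with hi | hi
    · simp [hi]
    · rw [hmono.injOn ⟨htn i, ht i⟩ ⟨ht₀n, ht₀⟩ (sub_eq_zero.1 hi)]
  rcases hrn.eq_or_lt with rfl | hr0
  · simp [sum_mul]
  rcases ht₀n.eq_or_lt with rfl | ht₀0
  · refine hdeg fun i => (sum_eq_zero_iff_of_nonneg fun i _ => ?_).1 hsum0 i (mem_univ i)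
    exact mul_nonneg (hw i) (sub_nonneg.2
      (hmono.monotoneOn ⟨le_rfl, zero_le_one⟩ ⟨htn i, ht i⟩ (htn i)))
  rcases ht₀.eq_or_lt with rfl | ht₀1
  · refine hdeg fun i => (sum_eq_zero_iff_of_nonpos fun i _ => ?_).1 hsum0 i (mem_univ i)
    exact mul_nonpos_of_nonneg_of_nonpos (hw i) (sub_nonpos.2
      (hmono.monotoneOn ⟨htn i, ht i⟩ ⟨zero_le_one, le_rfl⟩ (ht i)))
  have hle := sum_le_sum fun i (_ : i ∈ univ) => mul_le_mul_of_nonneg_left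
    (symmPow_tangent_le hk hk1 h hr0 hr ht₀0 ht₀1 (htn i) (ht i)) (hw i)
  rw [← sum_mul] at hle
  have hlhs : ∑ i, w i * (δ * (symmPow (k + 1) (r * t i) * skewPow k t₀
      - r * skewPow k (r * t₀) * symmPow (k + 1) (t i)))
      = δ * (skewPow k t₀ * ∑ i, w i * symmPow (k + 1) (t i * r)
        - r * skewPow k (r * t₀) * ∑ i, w i * symmPow (k + 1) (t i)) := by
    rw [mul_sum, mul_sum, ← sum_sub_distrib, mul_sum]
    refine sum_congr rfl fun i _ => ?_
    rw [mul_comm r (t i)]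
    ring
  rw [hlhs, heq, mul_comm r t₀] at hle
  have hpos := mul_skewPow_pos hk ht₀0 ht₀1
  have hle' : skewPow k t₀ * (δ * (∑ i, w i * symmPow (k + 1) (t i * r)
      - (∑ i, w i) * symmPow (k + 1) (t₀ * r))) ≤ 0 := by linarith
  have hmul : k * skewPow k t₀ * (δ * k * (∑ i, w i * symmPow (k + 1) (t i * r)
      - (∑ i, w i) * symmPow (k + 1) (t₀ * r))) ≤ 0 := by
    have := mul_nonpos_of_nonneg_of_nonpos (sq_nonneg k) hle'
    linarith
  have := nonpos_of_mul_nonpos_right hmul hpos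
  linarith

lemma sum_sum_symmPow_mul_le {ι κ : Type*} [Fintype ι] [Fintype κ] {δ k t₀ t₀' : ℝ}
    (w t : ι → ℝ) (w' t' : κ → ℝ) (hk : k ≠ 0) (hk1 : -1 < k)
    (h : 0 ≤ δ * ((k - 1) * (k - 2)))
    (hw : ∀ i, 0 ≤ w i) (hw' : ∀ j, 0 ≤ w' j) (ht : ∀ i, |t i| ≤ 1) (ht' : ∀ j, |t' j| ≤ 1)
    (ht₀ : |t₀| ≤ 1) (ht₀' : |t₀'| ≤ 1)
    (heq : ∑ i, w i * symmPow (k + 1) (t i) = (∑ i, w i) * symmPow (k + 1) t₀)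
    (heq' : ∑ j, w' j * symmPow (k + 1) (t' j) = (∑ j, w' j) * symmPow (k + 1) t₀') :
    δ * k * ∑ i, ∑ j, w i * w' j * symmPow (k + 1) (t i * t' j)
      ≤ δ * k * ((∑ i, w i) * (∑ j, w' j) * symmPow (k + 1) (t₀ * t₀')) := by
  have h1 := fun j => sum_symmPow_mul_le w t hk hk1 h hw ht (ht' j) ht₀ heq
  have h2 := sum_symmPow_mul_le w' t' hk hk1 h hw' ht' ht₀ ht₀' heq'
  calc δ * k * ∑ i, ∑ j, w i * w' j * symmPow (k + 1) (t i * t' j)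
      = ∑ j, w' j * (δ * k * ∑ i, w i * symmPow (k + 1) (t i * t' j)) := by
        rw [sum_comm, mul_sum]
        refine sum_congr rfl fun j _ => ?_
        simp only [mul_sum]
        refine sum_congr rfl fun i _ => ?_
        ring
    _ ≤ ∑ j, w' j * (δ * k * ((∑ i, w i) * symmPow (k + 1) (t₀ * t' j))) :=
        sum_le_sum fun j _ => mul_le_mul_of_nonneg_left (h1 j) (hw' j)
    _ = (∑ i, w i) * (δ * k * ∑ j, w' j * symmPow (k + 1) (t' j * t₀)) := by
        simp only [mul_sum (s := (univ : Finset κ))]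
        refine sum_congr rfl fun j _ => ?_
        rw [mul_comm t₀]
        ring
    _ ≤ (∑ i, w i) * (δ * k * ((∑ j, w' j) * symmPow (k + 1) (t₀' * t₀))) :=
        mul_le_mul_of_nonneg_left h2 (sum_nonneg fun i _ => hw i)
    _ = _ := by rw [mul_comm t₀']; ring

/-- The unnormalised `α`-norm form of the Arimoto conditional Rényi entropy. -/
lemma HA_eq_log_sum_rpow {X Y : Type*} [Fintype X] [Fintype Y] {α : ℝ} (hα : 0 < α)
    {p : X × Y → ℝ} (hp : ∀ ω, 0 ≤ p ω) :
    HA α p = α / (1 - α) * Real.log (∑ y, (∑ x, p (x, y) ^ α) ^ (1 / α)) := by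
  rw [HA]
  congr 2
  refine sum_congr rfl fun y _ => ?_
  have hm : 0 ≤ margY p y := sum_nonneg fun x _ => hp _
  have hsum : 0 ≤ ∑ x, p (x, y) ^ α := sum_nonneg fun x _ => Real.rpow_nonneg (hp _) _
  simp only [condXY, Real.div_rpow (hp _) hm]
  rw [← sum_div, Real.div_rpow hsum (Real.rpow_nonneg hm _), ← Real.rpow_mul hm,
    mul_one_div_cancel hα.ne', Real.rpow_one]
  rcases hm.eq_or_lt with h0 | h0
  · have hz : ∀ x, p (x, y) = 0 := fun x =>
      (sum_eq_zero_iff_of_nonneg fun x _ => hp (x, y)).1 h0.symm x (mem_univ x)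
    simp [← h0, hz, Real.zero_rpow hα.ne', Real.zero_rpow (inv_ne_zero hα.ne')]
  · rw [mul_div_cancel₀ _ h0.ne']

lemma sum_zmod_two (f : ZMod 2 → ℝ) : ∑ x, f x = f 0 + f 1 := Fin.sum_univ_two f

/-- The bias of the tilted conditional distribution of a binary variable given `y`. -/
noncomputable def tiltBias {Y : Type*} (α : ℝ) (p : ZMod 2 × Y → ℝ) (y : Y) : ℝ :=
  (p (0, y) ^ α - p (1, y) ^ α) / ∑ x, p (x, y) ^ α

section TiltBias

variable {Y : Type*} {α : ℝ} {p : ZMod 2 × Y → ℝ}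

lemma sum_rpow_nonneg (hp : ∀ ω, 0 ≤ p ω) (y : Y) : 0 ≤ ∑ x, p (x, y) ^ α :=
  sum_nonneg fun _ _ => Real.rpow_nonneg (hp _) _

lemma rpow_eq_tiltBias (hp : ∀ ω, 0 ≤ p ω) (y : Y) :
    p (0, y) ^ α = (∑ x, p (x, y) ^ α) * ((1 + tiltBias α p y) / 2) ∧
      p (1, y) ^ α = (∑ x, p (x, y) ^ α) * ((1 - tiltBias α p y) / 2) := by
  have h0 : 0 ≤ p (0, y) ^ α := Real.rpow_nonneg (hp _) _
  have h1 : 0 ≤ p (1, y) ^ α := Real.rpow_nonneg (hp _) _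
  rw [tiltBias, sum_zmod_two]
  rcases (add_nonneg h0 h1).eq_or_lt with h | h
  · rw [← h]
    exact ⟨by linarith, by linarith⟩
  · constructor <;> field_simp <;> ring

lemma abs_tiltBias_le_one (hp : ∀ ω, 0 ≤ p ω) (y : Y) : |tiltBias α p y| ≤ 1 := by
  have h0 : 0 ≤ p (0, y) ^ α := Real.rpow_nonneg (hp _) _
  have h1 : 0 ≤ p (1, y) ^ α := Real.rpow_nonneg (hp _) _
  rw [tiltBias, sum_zmod_two, abs_div, abs_of_nonneg (add_nonneg h0 h1)]
  exact div_le_one_of_le₀ (abs_le.2 ⟨by linarith, by linarith⟩) (add_nonneg h0 h1)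

lemma rpow_half_add_rpow_half (s : ℝ) {t : ℝ} (ht : |t| ≤ 1) :
    ((1 + t) / 2) ^ s + ((1 - t) / 2) ^ s = symmPow s t / 2 ^ s := by
  obtain ⟨h1, h2⟩ := abs_le.1 ht
  rw [Real.div_rpow (by linarith) zero_le_two, Real.div_rpow (by linarith) zero_le_two,
    ← add_div, symmPow]

lemma sum_rpow_mul_symmPow_tiltBias [Fintype Y] (hα : 0 < α) (hp : IsPMF p) :
    ∑ y, (∑ x, p (x, y) ^ α) ^ (1 / α) * symmPow (1 / α) (tiltBias α p y) = 2 ^ (1 / α) := by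
  have h2 : (0 : ℝ) < 2 ^ (1 / α) := by positivity
  have hy : ∀ y, (∑ x, p (x, y) ^ α) ^ (1 / α) * symmPow (1 / α) (tiltBias α p y)
      = 2 ^ (1 / α) * ∑ x, p (x, y) := fun y => by
    have ht := abs_tiltBias_le_one (α := α) hp.1 y
    obtain ⟨h1, h2⟩ := abs_le.1 ht
    have hA := sum_rpow_nonneg (α := α) hp.1 y
    obtain ⟨e0, e1⟩ := rpow_eq_tiltBias (α := α) hp.1 y
    have hinv : ∀ x, p (x, y) = (p (x, y) ^ α) ^ (1 / α) := fun x => by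
      rw [← Real.rpow_mul (hp.1 _), mul_one_div_cancel hα.ne', Real.rpow_one]
    rw [sum_zmod_two fun x => p (x, y), hinv 0, hinv 1, e0, e1,
      Real.mul_rpow hA (by linarith), Real.mul_rpow hA (by linarith), ← mul_add,
      rpow_half_add_rpow_half _ ht]
    field_simp
  simp only [hy]
  rw [← mul_sum, sum_comm, ← Fintype.sum_prod_type, hp.2, mul_one]

lemma sum_rpow_pos [Fintype Y] (hα : 0 < α) (hp : IsPMF p) :
    0 < ∑ y, (∑ x, p (x, y) ^ α) ^ (1 / α) := by
  have hnn : ∀ y, 0 ≤ (∑ x, p (x, y) ^ α) ^ (1 / α) := fun y =>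
    Real.rpow_nonneg (sum_rpow_nonneg hp.1 y) _
  refine (sum_nonneg fun y _ => hnn y).lt_of_ne fun h => ?_
  have hz : ∀ y, (∑ x, p (x, y) ^ α) ^ (1 / α) = 0 := fun y =>
    (sum_eq_zero_iff_of_nonneg fun y _ => hnn y).1 h.symm y (mem_univ y)
  have h2 := sum_rpow_mul_symmPow_tiltBias hα hp
  simp only [hz, zero_mul, sum_const_zero] at h2
  have : (0 : ℝ) < 2 ^ (1 / α) := by positivity
  linarith

lemma symmPow_pos {s t : ℝ} (ht : |t| ≤ 1) : 0 < symmPow s t := by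
  obtain ⟨h1, h2⟩ := abs_le.1 ht
  rcases h1.eq_or_lt with h | h
  · exact add_pos_of_nonneg_of_pos (Real.rpow_nonneg (by linarith) _)
      (Real.rpow_pos_of_pos (by linarith) _)
  · exact add_pos_of_pos_of_nonneg (Real.rpow_pos_of_pos (by linarith) _)
      (Real.rpow_nonneg (by linarith) _)

end TiltBias

lemma isPMF_combinedX2 {Y1 Y2 : Type*} [Fintype Y1] [Fintype Y2]
    {p1 : ZMod 2 × Y1 → ℝ} {p2 : ZMod 2 × Y2 → ℝ} (hp1 : IsPMF p1) (hp2 : IsPMF p2) :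
    IsPMF (combinedX2 p1 p2) := by
  refine ⟨fun ω => mul_nonneg (hp1.1 _) (hp2.1 _), ?_⟩
  have h1 := hp1.2
  have h2 := hp2.2
  rw [Fintype.sum_prod_type] at h1 h2
  simp only [Fintype.sum_prod_type, combinedX2, ← mul_sum, ← sum_mul]
  have hshift : ∀ x : ZMod 2, ∑ z, ∑ y1, p1 (z + x, y1) = 1 := fun x =>
    (Equiv.sum_comp (Equiv.addRight x) fun z => ∑ y1, p1 (z, y1)).trans h1
  simpa only [hshift, one_mul] using h2

lemma sum_rpow_combinedX2 {Y1 Y2 : Type*} [Fintype Y1] [Fintype Y2] {α : ℝ}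
    {p1 : ZMod 2 × Y1 → ℝ} {p2 : ZMod 2 × Y2 → ℝ}
    (hp1 : ∀ ω, 0 ≤ p1 ω) (hp2 : ∀ ω, 0 ≤ p2 ω) :
    ∑ w, (∑ x, combinedX2 p1 p2 (x, w) ^ α) ^ (1 / α)
      = (∑ y1, ∑ y2, (∑ x, p1 (x, y1) ^ α) ^ (1 / α) * (∑ x, p2 (x, y2) ^ α) ^ (1 / α)
        * symmPow (1 / α) (tiltBias α p1 y1 * tiltBias α p2 y2)) / 2 ^ (1 / α) := by
  rw [Fintype.sum_prod_type_right, Fintype.sum_prod_type, sum_div]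
  refine sum_congr rfl fun y1 _ => ?_
  rw [sum_div]
  refine sum_congr rfl fun y2 _ => ?_
  obtain ⟨e10, e11⟩ := rpow_eq_tiltBias (α := α) hp1 y1
  obtain ⟨e20, e21⟩ := rpow_eq_tiltBias (α := α) hp2 y2
  have hA1 := sum_rpow_nonneg (α := α) hp1 y1
  have hA2 := sum_rpow_nonneg (α := α) hp2 y2
  set A1 := ∑ x, p1 (x, y1) ^ α
  set A2 := ∑ x, p2 (x, y2) ^ α
  set t1 := tiltBias α p1 y1
  set t2 := tiltBias α p2 y2
  have ht : |t1 * t2| ≤ 1 := by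
    rw [abs_mul]
    exact mul_le_one₀ (abs_tiltBias_le_one hp1 y1) (abs_nonneg _) (abs_tiltBias_le_one hp2 y2)
  obtain ⟨hl, hu⟩ := abs_le.1 ht
  have h11 : (1 : ZMod 2) + 1 = 0 := rfl
  simp only [sum_zmod_two, combinedX2, Real.mul_rpow (hp1 _) (hp2 _), add_zero, zero_add, h11,
    e10, e11, e20, e21]
  have hz0 : A1 * ((1 + t1) / 2) * (A2 * ((1 + t2) / 2))
      + A1 * ((1 - t1) / 2) * (A2 * ((1 - t2) / 2)) = A1 * A2 * ((1 + t1 * t2) / 2) := by ring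
  have hz1 : A1 * ((1 - t1) / 2) * (A2 * ((1 + t2) / 2))
      + A1 * ((1 + t1) / 2) * (A2 * ((1 - t2) / 2)) = A1 * A2 * ((1 - t1 * t2) / 2) := by ring
  rw [hz0, hz1, Real.mul_rpow (mul_nonneg hA1 hA2) (by linarith),
    Real.mul_rpow (mul_nonneg hA1 hA2) (by linarith), ← mul_add, rpow_half_add_rpow_half _ ht,
    Real.mul_rpow hA1 hA2, mul_div_assoc]

/-- The binary Rényi entropy of order `1 / α` in terms of the bias `1 - 2 a`. -/
lemma binEnt_one_div {α a : ℝ} (hα : 0 < α) (ha : |1 - 2 * a| ≤ 1) :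
    binEnt (1 / α) a
      = -(α / (1 - α) * Real.log (symmPow (1 / α) (1 - 2 * a) / 2 ^ (1 / α))) := by
  have h : (1 : ℝ) / (1 - 1 / α) = -(α / (1 - α)) := by
    rcases eq_or_ne α 1 with rfl | h1
    · simp
    · have h2 : α - 1 ≠ 0 := sub_ne_zero.2 h1
      have h3 : 1 - α ≠ 0 := sub_ne_zero.2 h1.symm
      have h4 : 1 - 1 / α = (α - 1) / α := by field_simp
      rw [h4, one_div_div, ← div_neg, neg_sub]
  rw [binEnt, h, ← rpow_half_add_rpow_half _ ha, add_comm, neg_mul]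
  congr 5 <;> ring

/-- A distribution on `{0, 1} × Y` and the binary distribution of equal entropy have the same
mean of `symmPow`. -/
lemma sum_rpow_mul_symmPow_eq {Y : Type*} [Fintype Y] {α a : ℝ} {p : ZMod 2 × Y → ℝ}
    (hα : 0 < α) (hα1 : α ≠ 1) (hp : IsPMF p) (ha : |1 - 2 * a| ≤ 1)
    (he : binEnt (1 / α) a = HA α p) :
    (∑ y, (∑ x, p (x, y) ^ α) ^ (1 / α)) * symmPow (1 / α) (1 - 2 * a) = 2 ^ (1 / α) := by
  have hW := sum_rpow_pos hα hp
  have hG := symmPow_pos (s := 1 / α) ha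
  have h2 : (0 : ℝ) < 2 ^ (1 / α) := by positivity
  rw [binEnt_one_div hα ha, HA_eq_log_sum_rpow hα hp.1, ← mul_neg,
    mul_right_inj' (div_ne_zero hα.ne' (sub_ne_zero.2 hα1.symm)), ← Real.log_inv] at he
  have := Real.log_injOn_pos (inv_pos.2 (div_pos hG h2)) hW he
  rw [← this, inv_div, div_mul_cancel₀ _ hG.ne']

lemma mul_inv_mul_log_le {δ k E F : ℝ} (hk : k ≠ 0) (hE : 0 < E) (hF : 0 < F)
    (h : δ * k * E ≤ δ * k * F) :
    δ * (k⁻¹ * Real.log E) ≤ δ * (k⁻¹ * Real.log F) := by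
  have hk2 : (k ^ 2)⁻¹ * k = k⁻¹ := by field_simp
  have hk3 : 0 < (k ^ 2)⁻¹ := by positivity
  have hc : δ * k⁻¹ * E ≤ δ * k⁻¹ * F := by
    have := mul_le_mul_of_nonneg_left h hk3.le
    rw [← hk2]
    linarith
  rw [← mul_assoc, ← mul_assoc]
  rcases lt_trichotomy E F with hlt | rfl | hlt
  · exact mul_le_mul_of_nonneg_left (Real.log_le_log hE hlt.le) (by nlinarith)
  · exact le_rfl
  · exact mul_le_mul_of_nonpos_left (Real.log_le_log hF hlt.le) (by nlinarith)

/-- Both directions of the bound, selected by the sign of `δ`. -/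
lemma arimoto_bsc_signed {Y1 Y2 : Type*} [Fintype Y1] [Fintype Y2]
    {p1 : ZMod 2 × Y1 → ℝ} {p2 : ZMod 2 × Y2 → ℝ} (hp1 : IsPMF p1) (hp2 : IsPMF p2)
    {α : ℝ} (hα : 0 < α) (hα1 : α ≠ 1) {a1 a2 : ℝ}
    (ha1 : |1 - 2 * a1| ≤ 1) (ha2 : |1 - 2 * a2| ≤ 1)
    (he1 : binEnt (1 / α) a1 = HA α p1) (he2 : binEnt (1 / α) a2 = HA α p2)
    {δ : ℝ} (h : 0 ≤ δ * ((1 / α - 2) * (1 / α - 3))) :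
    δ * HA α (combinedX2 p1 p2)
      ≤ δ * (HA α p1 + HA α p2 - binEnt (1 / α) (a1 * (1 - a2) + a2 * (1 - a1))) := by
  have hconv : 1 - 2 * (a1 * (1 - a2) + a2 * (1 - a1)) = (1 - 2 * a1) * (1 - 2 * a2) := by ring
  have hc : |1 - 2 * (a1 * (1 - a2) + a2 * (1 - a1))| ≤ 1 := by
    rw [hconv, abs_mul]
    exact mul_le_one₀ ha1 (abs_nonneg _) ha2
  have hk : 1 / α - 1 ≠ 0 := by
    rw [sub_ne_zero, Ne, div_eq_iff hα.ne', one_mul]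
    exact hα1.symm
  have hk1 : -1 < 1 / α - 1 := by
    have := one_div_pos.2 hα
    linarith
  have hks : 1 / α - 1 + 1 = 1 / α := sub_add_cancel _ _
  have hmain := sum_sum_symmPow_mul_le (δ := δ) (k := 1 / α - 1) (t₀ := 1 - 2 * a1)
    (t₀' := 1 - 2 * a2)
    (fun y => (∑ x, p1 (x, y) ^ α) ^ (1 / α)) (tiltBias α p1)
    (fun y => (∑ x, p2 (x, y) ^ α) ^ (1 / α)) (tiltBias α p2) hk hk1
    (h.trans_eq (by ring))
    (fun y => Real.rpow_nonneg (sum_rpow_nonneg hp1.1 y) _)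
    (fun y => Real.rpow_nonneg (sum_rpow_nonneg hp2.1 y) _)
    (abs_tiltBias_le_one hp1.1) (abs_tiltBias_le_one hp2.1) ha1 ha2
    (by rw [hks, sum_rpow_mul_symmPow_tiltBias hα hp1,
      sum_rpow_mul_symmPow_eq hα hα1 hp1 ha1 he1])
    (by rw [hks, sum_rpow_mul_symmPow_tiltBias hα hp2,
      sum_rpow_mul_symmPow_eq hα hα1 hp2 ha2 he2])
  rw [hks, ← hconv] at hmain
  have hq : IsPMF (combinedX2 p1 p2) := isPMF_combinedX2 hp1 hp2
  have hE := sum_rpow_pos hα hq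
  rw [binEnt_one_div hα hc, HA_eq_log_sum_rpow hα hp1.1, HA_eq_log_sum_rpow hα hp2.1,
    HA_eq_log_sum_rpow hα hq.1, sub_neg_eq_add, ← mul_add, ← mul_add]
  have hW1 := sum_rpow_pos hα hp1
  have hW2 := sum_rpow_pos hα hp2
  have hG := symmPow_pos (s := 1 / α) hc
  have h2 : (0 : ℝ) < 2 ^ (1 / α) := by positivity
  have hcoef : α / (1 - α) = (1 / α - 1)⁻¹ := by
    rw [← inv_div]; congr 1; field_simp
  rw [sum_rpow_combinedX2 hp1.1 hp2.1] at hE ⊢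
  rw [← Real.log_mul hW1.ne' hW2.ne', ← Real.log_mul (mul_pos hW1 hW2).ne' (div_pos hG h2).ne',
    hcoef, ← mul_div_assoc]
  have hmain' := div_le_div_of_nonneg_right hmain h2.le
  rw [mul_div_assoc, mul_div_assoc] at hmain'
  have hF : 0 < (∑ y, (∑ x, p1 (x, y) ^ α) ^ (1 / α)) * (∑ y, (∑ x, p2 (x, y) ^ α) ^ (1 / α))
      * symmPow (1 / α) (1 - 2 * (a1 * (1 - a2) + a2 * (1 - a1))) / 2 ^ (1 / α) := by positivity
  exact mul_inv_mul_log_le hk hE hF hmain'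

/-- **Arimoto BSC-type upper bound for the variable node**
(Theorem on `H^A_α(X₂|X₁⊕X₂, Y₁Y₂)`). -/
theorem arimoto_bsc_bound
    (p1 : ZMod 2 × Y1 → ℝ) (p2 : ZMod 2 × Y2 → ℝ) (hp1 : IsPMF p1) (hp2 : IsPMF p2)
    (α : ℝ) (hα0 : 0 < α)
    (a1 a2 : ℝ) (ha1 : a1 ∈ Set.Icc (0:ℝ) (1/2)) (ha2 : a2 ∈ Set.Icc (0:ℝ) (1/2))
    (he1 : binEnt (1/α) a1 = HA α p1) (he2 : binEnt (1/α) a2 = HA α p2) :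
    (α ∈ Set.Ioc (0:ℝ) (1/3) ∪ Set.Ico (1/2:ℝ) 1 ∪ Set.Ioi (1:ℝ) →
      HA α (combinedX2 p1 p2) ≤
        HA α p1 + HA α p2 - binEnt (1/α) (a1 * (1 - a2) + a2 * (1 - a1))) ∧
    (α ∈ Set.Icc (1/3:ℝ) (1/2) →
      HA α (combinedX2 p1 p2) ≥
        HA α p1 + HA α p2 - binEnt (1/α) (a1 * (1 - a2) + a2 * (1 - a1))) ∧
    (α = 1/3 ∨ α = 1/2 →
      HA α (combinedX2 p1 p2) =
        HA α p1 + HA α p2 - binEnt (1/α) (a1 * (1 - a2) + a2 * (1 - a1))) := by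
  have habs : ∀ a ∈ Set.Icc (0 : ℝ) (1 / 2), |1 - 2 * a| ≤ 1 := fun a ha =>
    abs_le.2 ⟨by linarith [ha.2], by linarith [ha.1]⟩
  have hfac : ∀ δ : ℝ, δ * ((1 / α - 2) * (1 / α - 3))
      = δ * ((1 - 2 * α) * (1 - 3 * α)) / α ^ 2 := fun δ => by
    field_simp
  have hsigned : ∀ δ : ℝ, α ≠ 1 → 0 ≤ δ * ((1 - 2 * α) * (1 - 3 * α)) →
      δ * HA α (combinedX2 p1 p2)
        ≤ δ * (HA α p1 + HA α p2 - binEnt (1/α) (a1 * (1 - a2) + a2 * (1 - a1))) :=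
    fun δ hα1 h => arimoto_bsc_signed hp1 hp2 hα0 hα1 (habs a1 ha1) (habs a2 ha2) he1 he2
      (by rw [hfac]; exact div_nonneg h (sq_nonneg α))
  have hupper : α ≠ 1 → 0 ≤ (1 - 2 * α) * (1 - 3 * α) → HA α (combinedX2 p1 p2)
      ≤ HA α p1 + HA α p2 - binEnt (1/α) (a1 * (1 - a2) + a2 * (1 - a1)) := fun hα1 h => by
    simpa only [one_mul] using hsigned 1 hα1 (by rwa [one_mul])
  have hlower : α ≠ 1 → (1 - 2 * α) * (1 - 3 * α) ≤ 0 → HA α (combinedX2 p1 p2)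
      ≥ HA α p1 + HA α p2 - binEnt (1/α) (a1 * (1 - a2) + a2 * (1 - a1)) := fun hα1 h => by
    have := hsigned (-1) hα1 (by linarith)
    linarith
  refine ⟨?_, fun hα => ?_, ?_⟩
  · rintro ((hα | hα) | hα)
    · obtain ⟨-, h⟩ := hα
      exact hupper (ne_of_lt (by linarith)) (mul_nonneg (by linarith) (by linarith))
    · obtain ⟨h, h'⟩ := hα
      exact hupper h'.ne (mul_nonneg_of_nonpos_of_nonpos (by linarith) (by linarith))
    · have h : 1 < α := hα
      exact hupper h.ne' (mul_nonneg_of_nonpos_of_nonpos (by linarith) (by linarith))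
  · obtain ⟨h, h'⟩ := hα
    exact hlower (ne_of_lt (by linarith)) (mul_nonpos_of_nonneg_of_nonpos (by linarith) (by linarith))
  · rintro (rfl | rfl)
    · exact le_antisymm (hupper (by norm_num) (by norm_num)) (hlower (by norm_num) (by norm_num))
    · exact le_antisymm (hupper (by norm_num) (by norm_num)) (hlower (by norm_num) (by norm_num))
end
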